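/- Let L be an m×m real symmetric matrix whose kernel is exactly the span of the all-ones vector 1_m, and let L̄ = L ⊗ I_n. Then a vector x ∈ ℝ^{mn} minimizes x ↦ (1/2)‖Āx − b‖² over the set {x : L̄ x = 0} if and only if x = 1_m ⊗ y for some y ∈ ℝ^n minimizing y ↦ (1/2)Σ_{i=1}^m ‖A_i y − b_i‖² over ℝ^n. -/

import Mathlib

open Matrix
open scoped Kronecker

noncomputable section

/-- `M̄ = M ⊗ I_n`. -/
def bar (n : ℕ) {m : ℕ} (M : Matrix (Fin m) (Fin m) ℝ) :
    Matrix (Fin m × Fin n) (Fin m × Fin n) ℝ :=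
  M ⊗ₖ (1 : Matrix (Fin n) (Fin n) ℝ)

/-- `D`: the diagonal matrix of row sums of `W`. -/
def rowSumDiag {m : ℕ} (W : Matrix (Fin m) (Fin m) ℝ) : Matrix (Fin m) (Fin m) ℝ :=
  Matrix.diagonal fun i => ∑ j, W i j

/-- `Ā = blockdiag(A_1, …, A_m)`. -/
def blockDiag {m n : ℕ} (ni : Fin m → ℕ) (A : ∀ i, Matrix (Fin (ni i)) (Fin n) ℝ) :
    Matrix ((i : Fin m) × Fin (ni i)) (Fin m × Fin n) ℝ :=
  fun p q => if p.1 = q.1 then A p.1 p.2 q.2 else 0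

/-- `b = col(b_1, …, b_m)`. -/
def bvec {m : ℕ} {ni : Fin m → ℕ} (b : ∀ i, Fin (ni i) → ℝ) :
    (i : Fin m) × Fin (ni i) → ℝ := fun p => b p.1 p.2

theorem bar_mulVec_apply {m n : ℕ} (M : Matrix (Fin m) (Fin m) ℝ) (w : Fin m × Fin n → ℝ)
    (i : Fin m) (k : Fin n) :
    (bar n M *ᵥ w) (i, k) = (M *ᵥ fun j => w (j, k)) i := by
  simp [bar, mulVec, dotProduct, Fintype.sum_prod_type, Matrix.one_apply]

/-- If the kernel of `L` consists of the constant vectors, then the kernel of `L ⊗ I_n` consists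
of the vectors `1_m ⊗ y`. -/
theorem bar_mulVec_eq_zero_iff {m n : ℕ} {L : Matrix (Fin m) (Fin m) ℝ}
    (hker : ∀ v : Fin m → ℝ, L *ᵥ v = 0 ↔ ∃ a : ℝ, v = fun _ => a) (w : Fin m × Fin n → ℝ) :
    bar n L *ᵥ w = 0 ↔ ∃ y : Fin n → ℝ, w = fun p => y p.2 := by
  constructor
  · intro h
    have hconst (k : Fin n) : ∃ a : ℝ, (fun j => w (j, k)) = fun _ => a :=
      (hker _).1 <| funext fun i => by rw [← bar_mulVec_apply, h]; rfl
    choose y hy using hconst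
    exact ⟨y, funext fun p => congrFun (hy p.2) p.1⟩
  · rintro ⟨y, rfl⟩
    ext ⟨i, k⟩
    rw [bar_mulVec_apply, (hker _).2 ⟨y k, rfl⟩]
    rfl

theorem blockDiag_mulVec_apply {m n : ℕ} (ni : Fin m → ℕ)
    (A : ∀ i, Matrix (Fin (ni i)) (Fin n) ℝ) (w : Fin m × Fin n → ℝ)
    (i : Fin m) (r : Fin (ni i)) :
    (blockDiag ni A *ᵥ w) ⟨i, r⟩ = (A i *ᵥ fun k => w (i, k)) r := by
  simp only [_root_.blockDiag, mulVec, dotProduct, Fintype.sum_prod_type, ite_mul, zero_mul]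
  rw [Finset.sum_comm]
  simp

theorem blockDiag_residual_dotProduct {m n : ℕ} (ni : Fin m → ℕ)
    (A : ∀ i, Matrix (Fin (ni i)) (Fin n) ℝ) (b : ∀ i, Fin (ni i) → ℝ) (y : Fin n → ℝ) :
    (blockDiag ni A *ᵥ (fun p => y p.2) - bvec b) ⬝ᵥ
        (blockDiag ni A *ᵥ (fun p => y p.2) - bvec b) =
      ∑ i, (A i *ᵥ y - b i) ⬝ᵥ (A i *ᵥ y - b i) := by
  simp only [dotProduct, Fintype.sum_sigma, Pi.sub_apply, blockDiag_mulVec_apply, bvec]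

theorem stmt15 (m n : ℕ) (ni : Fin m → ℕ)
    (A : ∀ i, Matrix (Fin (ni i)) (Fin n) ℝ) (b : ∀ i, Fin (ni i) → ℝ)
    (L : Matrix (Fin m) (Fin m) ℝ) (hLsymm : L.IsSymm)
    (hker : ∀ v : Fin m → ℝ, L.mulVec v = 0 ↔ ∃ a : ℝ, v = fun _ => a)
    (x : Fin m × Fin n → ℝ) :
    ((bar n L).mulVec x = 0 ∧ ∀ w : Fin m × Fin n → ℝ, (bar n L).mulVec w = 0 →
        (1 / 2) * (((blockDiag ni A).mulVec x - bvec b) ⬝ᵥ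
                    ((blockDiag ni A).mulVec x - bvec b)) ≤
        (1 / 2) * (((blockDiag ni A).mulVec w - bvec b) ⬝ᵥ
                    ((blockDiag ni A).mulVec w - bvec b)))
    ↔ ∃ y : Fin n → ℝ, (x = fun p => y p.2) ∧
        ∀ y' : Fin n → ℝ,
          (1 / 2) * ∑ i, (((A i).mulVec y - b i) ⬝ᵥ ((A i).mulVec y - b i)) ≤
          (1 / 2) * ∑ i, (((A i).mulVec y' - b i) ⬝ᵥ ((A i).mulVec y' - b i)) := by
  constructor
  · rintro ⟨hx, hmin⟩
    obtain ⟨y, rfl⟩ := (bar_mulVec_eq_zero_iff hker x).1 hx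
    refine ⟨y, rfl, fun y' => ?_⟩
    simpa only [blockDiag_residual_dotProduct] using
      hmin (fun p => y' p.2) ((bar_mulVec_eq_zero_iff hker _).2 ⟨y', rfl⟩)
  · rintro ⟨y, rfl, hmin⟩
    refine ⟨(bar_mulVec_eq_zero_iff hker _).2 ⟨y, rfl⟩, fun w hw => ?_⟩
    obtain ⟨y', rfl⟩ := (bar_mulVec_eq_zero_iff hker w).1 hw
    simpa only [blockDiag_residual_dotProduct] using hmin y'
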